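/- arXiv:2305.00516 — 6 statements merged into one kernel-verified Lean document; each statement's English description precedes it below -/
import Mathlib

section
/- Let β, γ, ζ, κ be nonzero real numbers and α, σ real numbers, and set C = αγ/(βκ). Assume (1 − C/2)² ≥ 4ζσ/κ and let P₀ = (3/(4ζ))·((1 − C/2) + √((1 − C/2)² − 4ζσ/κ)) or P₀ = (3/(4ζ))·((1 − C/2) − √((1 − C/2)² − 4ζσ/κ)). Define ε = −κβζ/(3γ²), Δ² = γP₀/β, and Ξ² = (−(5/3)P₀γ + γ/ζ + γ²α/(κβζ))/β. Then for every real Ω the polynomial identity (1/β)·[κβ(Ω² − Δ²)(−γ − ζβ(Ω² − Δ²))/γ² − σ − αΩ²] = ε·(3Ω² − Δ²)·(Ξ² + Ω²) holds. -/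
theorem stmt_0 (β γ ζ κ α σ C P₀ ε Δsq Ξsq : ℝ)
    (hβ : β ≠ 0) (hγ : γ ≠ 0) (hζ : ζ ≠ 0) (hκ : κ ≠ 0)
    (hC : C = α * γ / (β * κ))
    (hdisc : (1 - C / 2) ^ 2 ≥ 4 * ζ * σ / κ)
    (hP : P₀ = (3 / (4 * ζ)) * ((1 - C / 2) + Real.sqrt ((1 - C / 2) ^ 2 - 4 * ζ * σ / κ)) ∨
          P₀ = (3 / (4 * ζ)) * ((1 - C / 2) - Real.sqrt ((1 - C / 2) ^ 2 - 4 * ζ * σ / κ)))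
    (hε : ε = -(κ * β * ζ) / (3 * γ ^ 2))
    (hΔ : Δsq = γ * P₀ / β)
    (hΞ : Ξsq = (-(5 / 3) * P₀ * γ + γ / ζ + γ ^ 2 * α / (κ * β * ζ)) / β) :
    ∀ Ω : ℝ,
      (1 / β) * (κ * β * (Ω ^ 2 - Δsq) * (-γ - ζ * β * (Ω ^ 2 - Δsq)) / γ ^ 2 - σ - α * Ω ^ 2)
        = ε * (3 * Ω ^ 2 - Δsq) * (Ξsq + Ω ^ 2) := by
  intro Ω
  have hs := Real.sq_sqrt (sub_nonneg.mpr hdisc)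
  have hP_root : 4 * κ * ζ * P₀ ^ 2 - 6 * κ * (1 - C / 2) * P₀ + 9 * σ = 0 := by
    set s := Real.sqrt ((1 - C / 2) ^ 2 - 4 * ζ * σ / κ)
    have hσ : σ = κ * ((1 - C / 2) ^ 2 - s ^ 2) / (4 * ζ) := by
      rw [hs]
      field_simp
      ring
    rw [hσ]
    rcases hP with rfl | rfl <;> field_simp <;> ring
  have hσ : σ = (6 * κ * (1 - C / 2) * P₀ - 4 * κ * ζ * P₀ ^ 2) / 9 := by linarith
  rw [hσ, hC, hε, hΔ, hΞ]
  field_simp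
  ring
end

section
/- Let β, γ, ζ, κ be nonzero real numbers and α, σ real numbers, with C = αγ/(βκ), (1 − C/2)² ≥ 4ζσ/κ, P₀ = (3/(4ζ))·((1 − C/2) ± √((1 − C/2)² − 4ζσ/κ)), ε = −κβζ/(3γ²), Δ² = γP₀/β, and Ξ² = (−(5/3)P₀γ + γ/ζ + γ²α/(κβζ))/β. Then for every real Ω with 3Ω² ≠ Δ², the right-hand side of the chirp ODE, namely [κβ(Ω² − Δ²)(−γ − ζβ(Ω² − Δ²))/γ² − σ − αΩ²]·(Ω² − Δ²)/(β(3Ω² − Δ²)), equals ε·(Ω² − Δ²)·(Ξ² + Ω²). -/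
theorem stmt_1 (β γ ζ κ α σ C P₀ ε Δsq Ξsq : ℝ)
    (hβ : β ≠ 0) (hγ : γ ≠ 0) (hζ : ζ ≠ 0) (hκ : κ ≠ 0)
    (hC : C = α * γ / (β * κ))
    (hdisc : (1 - C / 2) ^ 2 ≥ 4 * ζ * σ / κ)
    (hP : P₀ = (3 / (4 * ζ)) * ((1 - C / 2) + Real.sqrt ((1 - C / 2) ^ 2 - 4 * ζ * σ / κ)) ∨
          P₀ = (3 / (4 * ζ)) * ((1 - C / 2) - Real.sqrt ((1 - C / 2) ^ 2 - 4 * ζ * σ / κ)))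
    (hε : ε = -(κ * β * ζ) / (3 * γ ^ 2))
    (hΔ : Δsq = γ * P₀ / β)
    (hΞ : Ξsq = (-(5 / 3) * P₀ * γ + γ / ζ + γ ^ 2 * α / (κ * β * ζ)) / β) :
    ∀ Ω : ℝ, 3 * Ω ^ 2 ≠ Δsq →
      (κ * β * (Ω ^ 2 - Δsq) * (-γ - ζ * β * (Ω ^ 2 - Δsq)) / γ ^ 2 - σ - α * Ω ^ 2)
          * (Ω ^ 2 - Δsq) / (β * (3 * Ω ^ 2 - Δsq))
        = ε * (Ω ^ 2 - Δsq) * (Ξsq + Ω ^ 2) := by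
  intro Ω hΩ
  have hΩ' : 3 * Ω ^ 2 - Δsq ≠ 0 := sub_ne_zero.mpr hΩ
  have hs := Real.sq_sqrt (sub_nonneg.mpr hdisc)
  set s := Real.sqrt ((1 - C / 2) ^ 2 - 4 * ζ * σ / κ)
  have hsP : (4 * ζ * P₀ / 3 - (1 - C / 2)) ^ 2 = (1 - C / 2) ^ 2 - 4 * ζ * σ / κ := by
    rw [← hs]
    rcases hP with rfl | rfl <;> field_simp <;> ring
  have hσ : σ = κ * (2 / 3 * P₀ * (1 - C / 2) - 4 / 9 * ζ * P₀ ^ 2) := by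
    field_simp at hsP ⊢
    apply mul_left_cancel₀ hζ
    linear_combination (3 / 16) * hsP
  have hfactor : κ * β * (Ω ^ 2 - Δsq) * (-γ - ζ * β * (Ω ^ 2 - Δsq)) / γ ^ 2 - σ - α * Ω ^ 2
      = β * (3 * Ω ^ 2 - Δsq) * (ε * (Ξsq + Ω ^ 2)) := by
    rw [hσ, hC, hε, hΞ, hΔ]
    field_simp
    ring
  rw [hfactor]
  field_simp
end

section
/- Let β, γ, χ be reals with β ≠ 0 and χ ≠ 0, let κ, ζ, σ, α, Δ be reals, and let Ω : ℝ → ℝ be differentiable with γ² + 4βχ(Δ² − Ω(t)²) > 0 for all t. Define A(t) = √(γ² + 4βχ(Δ² − Ω(t)²)) and P(t) = (A(t) − γ)/(2χ), and assume for all t that A(t) ≠ 0, A(t) ≠ γ, P(t) ≠ 0, and 4χβΩ(t)² + (γ − A(t))A(t) ≠ 0. Then the amplitude balance equation κP(t) − κζP(t)² = σ + αΩ(t)² + βΩ(t)P'(t)/P(t) + βΩ'(t) holds for all t if and only if Ω'(t) = −(σ + αΩ(t)² + (κ/(4χ²))(γ − A(t))(2χ + ζ(γ − A(t))))·(γ −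 A(t))·A(t)/(β(4χβΩ(t)² + (γ − A(t))A(t))) for all t. -/
/-- The derivative of the power `P = (A - γ) / (2χ)`, where `A = √(γ² + 4βχ(Δ² - Ω²))`. -/
theorem hasDerivAt_power {β γ χ Δ : ℝ} (hχ : χ ≠ 0) {Ω : ℝ → ℝ} {t w : ℝ}
    (hΩ : HasDerivAt Ω w t) (hpos : γ ^ 2 + 4 * β * χ * (Δ ^ 2 - Ω t ^ 2) > 0) :
    HasDerivAt (fun s => (√(γ ^ 2 + 4 * β * χ * (Δ ^ 2 - Ω s ^ 2)) - γ) / (2 * χ))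
      (-(2 * β * Ω t * w) / √(γ ^ 2 + 4 * β * χ * (Δ ^ 2 - Ω t ^ 2))) t := by
  have hrad := (((hΩ.pow 2).const_sub (Δ ^ 2)).const_mul (4 * β * χ)).const_add (γ ^ 2)
  have hsqrt : √(γ ^ 2 + 4 * β * χ * (Δ ^ 2 - Ω t ^ 2)) ≠ 0 := (Real.sqrt_pos.2 hpos).ne'
  refine (((hrad.sqrt hpos.ne').sub_const γ).div_const (2 * χ)).congr_deriv ?_
  simp only [Pi.pow_apply, Nat.cast_ofNat, Nat.add_one_sub_one, pow_one]
  field_simp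
  ring

/-- With `a = A`, `x = Ω` and `w = Ω'`, the amplitude balance is linear in `w` and can be solved
for it. -/
theorem amplitude_balance_iff {β γ χ κ ζ σ α a x w : ℝ} (hβ : β ≠ 0) (hχ : χ ≠ 0)
    (ha : a ≠ 0) (haγ : a ≠ γ) (hden : 4 * χ * β * x ^ 2 + (γ - a) * a ≠ 0) :
    κ * ((a - γ) / (2 * χ)) - κ * ζ * ((a - γ) / (2 * χ)) ^ 2
        = σ + α * x ^ 2 + β * x * (-(2 * β * x * w) / a) / ((a - γ) / (2 * χ)) + β * w
    ↔ w = -((σ + α * x ^ 2 + (κ / (4 * χ ^ 2)) * (γ - a) * (2 * χ + ζ * (γ - a)))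
            * (γ - a) * a) / (β * (4 * χ * β * x ^ 2 + (γ - a) * a)) := by
  have hb : γ - a ≠ 0 := sub_ne_zero.2 haγ.symm
  have hgain : κ * ((a - γ) / (2 * χ)) - κ * ζ * ((a - γ) / (2 * χ)) ^ 2
      = -((κ / (4 * χ ^ 2)) * (γ - a) * (2 * χ + ζ * (γ - a))) := by
    field_simp
    ring
  have hchirp : β * x * (-(2 * β * x * w) / a) / ((a - γ) / (2 * χ)) + β * w
      = w * (β * (4 * χ * β * x ^ 2 + (γ - a) * a)) / ((γ - a) * a) := by
    rw [← neg_sub γ a]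
    field_simp
    ring
  rw [add_assoc (σ + α * x ^ 2), hgain, hchirp, eq_div_iff (mul_ne_zero hβ hden),
    ← sub_eq_iff_eq_add', eq_div_iff (mul_ne_zero hb ha), eq_comm]
  ring_nf


theorem stmt_3 (β γ χ κ ζ σ α Δ : ℝ) (hβ : β ≠ 0) (hχ : χ ≠ 0)
    (Ω : ℝ → ℝ) (hΩ : Differentiable ℝ Ω)
    (hpos : ∀ t, γ ^ 2 + 4 * β * χ * (Δ ^ 2 - Ω t ^ 2) > 0)
    (A : ℝ → ℝ) (hA : ∀ t, A t = Real.sqrt (γ ^ 2 + 4 * β * χ * (Δ ^ 2 - Ω t ^ 2)))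
    (P : ℝ → ℝ) (hP : ∀ t, P t = (A t - γ) / (2 * χ))
    (hAne : ∀ t, A t ≠ 0) (hAγ : ∀ t, A t ≠ γ) (hPne : ∀ t, P t ≠ 0)
    (hden : ∀ t, 4 * χ * β * Ω t ^ 2 + (γ - A t) * A t ≠ 0) :
    (∀ t, κ * P t - κ * ζ * P t ^ 2
        = σ + α * Ω t ^ 2 + β * Ω t * deriv P t / P t + β * deriv Ω t)
    ↔ (∀ t, deriv Ω t
        = -((σ + α * Ω t ^ 2
              + (κ / (4 * χ ^ 2)) * (γ - A t) * (2 * χ + ζ * (γ - A t)))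
            * (γ - A t) * A t)
          / (β * (4 * χ * β * Ω t ^ 2 + (γ - A t) * A t))) := by
  refine forall_congr' fun t => ?_
  have hderiv : deriv P t = -(2 * β * Ω t * deriv Ω t) / A t := by
    have hPfun : P = fun s => (√(γ ^ 2 + 4 * β * χ * (Δ ^ 2 - Ω s ^ 2)) - γ) / (2 * χ) :=
      funext fun s => by rw [hP, hA]
    rw [hPfun, hA]
    exact (hasDerivAt_power hχ (hΩ t).hasDerivAt (hpos t)).deriv
  rw [hderiv, hP]
  exact amplitude_balance_iff hβ hχ (hAne t) (hAγ t) (hden t)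
end

section
/- Let Θ, Δ, Ξ be positive reals with Θ > Δ² + Ξ². Then the Gibbs free energy 𝓕 = −2Θ·(Δ·ln(Θ/(Δ² + Ξ²)) − Ξ·arctan(Δ/Ξ) + Δ) is strictly negative. -/
theorem Real.arctan_lt_self_of_pos {x : ℝ} (hx : 0 < x) : Real.arctan x < x := by
  simpa only [Real.tan_arctan] using
    Real.lt_tan (Real.arctan_pos.mpr hx) (Real.arctan_lt_pi_div_two x)

open Real in
theorem stmt_10 (Θ Δ Ξ : ℝ) (hΘ : 0 < Θ) (hΔ : 0 < Δ) (hΞ : 0 < Ξ)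
    (h : Θ > Δ ^ 2 + Ξ ^ 2) :
    -2 * Θ * (Δ * Real.log (Θ / (Δ ^ 2 + Ξ ^ 2)) - Ξ * arctan (Δ / Ξ) + Δ) < 0 := by
  have hlog : 0 < Δ * Real.log (Θ / (Δ ^ 2 + Ξ ^ 2)) :=
    mul_pos hΔ (Real.log_pos ((one_lt_div (by positivity)).mpr h))
  have harctan : Ξ * arctan (Δ / Ξ) < Δ := by
    calc Ξ * arctan (Δ / Ξ) < Ξ * (Δ / Ξ) :=
          mul_lt_mul_of_pos_left (Real.arctan_lt_self_of_pos (div_pos hΔ hΞ)) hΞ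
      _ = Δ := mul_div_cancel₀ Δ hΞ.ne'
  exact mul_neg_of_neg_of_pos (by linarith) (by linarith)
end

section
/- Let Σ ∈ (0, 36/169) and set C = 2 − 4√Σ, P₀' = (3/4)·((1 − C/2) + √((1 − C/2)² − 4Σ)), Δ'² = P₀', and Ξ'² = C + 1 − (5/3)Δ'². Then: (i) the discriminant (1 − C/2)² − 4Σ equals 0 and P₀' = (3/2)√Σ; (ii) Ξ'² = (6 − 13√Σ)/2 > 0; and (iii) the dimensionless energy E' = (6/√(Ξ'²))·arctan(√(Δ'²)/√(Ξ'²)) equals (6√2/√(6 − 13√Σ))·arctan(√3·Σ^{1/4}/√(6 − 13√Σ)). -/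
theorem stmt_16 (Sig : ℝ) (hSig : Sig ∈ Set.Ioo (0 : ℝ) (36 / 169))
    (C P₀' Δsq' Ξsq' E' : ℝ)
    (hC : C = 2 - 4 * Real.sqrt Sig)
    (hP : P₀' = (3 / 4) * ((1 - C / 2) + Real.sqrt ((1 - C / 2) ^ 2 - 4 * Sig)))
    (hΔ : Δsq' = P₀')
    (hΞ : Ξsq' = C + 1 - (5 / 3) * Δsq')
    (hE : E' = (6 / Real.sqrt Ξsq') * Real.arctan (Real.sqrt Δsq' / Real.sqrt Ξsq')) :
    (1 - C / 2) ^ 2 - 4 * Sig = 0 ∧ P₀' = (3 / 2) * Real.sqrt Sig ∧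
    (Ξsq' = (6 - 13 * Real.sqrt Sig) / 2 ∧ 0 < Ξsq') ∧
    E' = (6 * Real.sqrt 2 / Real.sqrt (6 - 13 * Real.sqrt Sig)) *
        Real.arctan (Real.sqrt 3 * Sig ^ ((1 : ℝ) / 4) /
          Real.sqrt (6 - 13 * Real.sqrt Sig)) := by
  obtain ⟨h0, h1⟩ := hSig
  have hquarter : Sig ^ ((1 : ℝ) / 4) = √(√Sig) := by
    rw [Real.sqrt_eq_rpow, Real.sqrt_eq_rpow, ← Real.rpow_mul h0.le]
    norm_num
  have hsq : √Sig ^ 2 = Sig := Real.sq_sqrt h0.le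
  have hlt : √Sig < 6 / 13 := by
    rw [Real.sqrt_lt' (by norm_num)]
    norm_num
    exact h1
  have hdisc : (1 - C / 2) ^ 2 - 4 * Sig = 0 := by
    rw [hC]
    linear_combination 4 * hsq
  have hP₀ : P₀' = (3 / 2) * √Sig := by
    rw [hP, hdisc, Real.sqrt_zero, hC]
    ring
  have hΞ₀ : Ξsq' = (6 - 13 * √Sig) / 2 := by
    rw [hΞ, hΔ, hP₀, hC]
    ring
  have hpos : 0 < 6 - 13 * √Sig := by linarith
  refine ⟨hdisc, hP₀, ⟨hΞ₀, by rw [hΞ₀]; positivity⟩, ?_⟩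
  have hΔ₀ : √Δsq' = √3 * √(√Sig) / √2 := by
    rw [hΔ, hP₀, Real.sqrt_mul (by norm_num), Real.sqrt_div (by norm_num)]
    ring
  have hΞ₁ : √Ξsq' = √(6 - 13 * √Sig) / √2 := by
    rw [hΞ₀, Real.sqrt_div hpos.le]
  have h2 : √(2 : ℝ) ≠ 0 := by positivity
  rw [hE, hΔ₀, hΞ₁, hquarter, div_div_div_cancel_right₀ h2, div_div_eq_mul_div]
end

section
/- The function Σ ↦ (6√2/√(6 − 13√Σ))·arctan(√3·Σ^{1/4}/√(6 − 13√Σ)) tends to +∞ as Σ → 36/169 from the left (through Σ ∈ (0, 36/169)). -/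
open Filter Topology in
/-- The denominator `√(6 - 13 √x)` tends to `0` through positive values as `x ↑ 36 / 169`. -/
lemma tendsto_sqrt_six_sub_thirteen_mul_sqrt :
    Tendsto (fun x : ℝ => Real.sqrt (6 - 13 * Real.sqrt x))
      (𝓝[Set.Ioo 0 (36 / 169)] (36 / 169)) (𝓝[>] 0) := by
  have hsqrt : Real.sqrt (36 / 169) = 6 / 13 := by
    rw [show (36 / 169 : ℝ) = (6 / 13) ^ 2 by norm_num, Real.sqrt_sq (by norm_num)]
  refine tendsto_nhdsWithin_iff.2 ⟨?_, ?_⟩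
  · have hcont : Continuous fun x : ℝ => Real.sqrt (6 - 13 * Real.sqrt x) := by fun_prop
    have h := hcont.tendsto (36 / 169)
    rw [hsqrt, show (6 - 13 * (6 / 13) : ℝ) = 0 by norm_num, Real.sqrt_zero] at h
    exact h.mono_left nhdsWithin_le_nhds
  · filter_upwards [self_mem_nhdsWithin] with x hx
    have hlt : Real.sqrt x < 6 / 13 := hsqrt ▸ Real.sqrt_lt_sqrt hx.1.le hx.2
    exact Real.sqrt_pos.2 (by linarith)

theorem stmt_19 :
    Filter.Tendsto
      (fun Sig : ℝ => (6 * Real.sqrt 2 / Real.sqrt (6 - 13 * Real.sqrt Sig)) *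
        Real.arctan (Real.sqrt 3 * Sig ^ ((1 : ℝ) / 4) /
          Real.sqrt (6 - 13 * Real.sqrt Sig)))
      (nhdsWithin (36 / 169) (Set.Ioo 0 (36 / 169))) Filter.atTop := by
  have hinv := tendsto_sqrt_six_sub_thirteen_mul_sqrt.inv_tendsto_nhdsGT_zero
  have hnum : Filter.Tendsto (fun x : ℝ => Real.sqrt 3 * x ^ ((1 : ℝ) / 4))
      (nhdsWithin (36 / 169) (Set.Ioo 0 (36 / 169)))
      (nhds (Real.sqrt 3 * (36 / 169 : ℝ) ^ ((1 : ℝ) / 4))) :=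
    ((Real.continuousAt_rpow_const _ _ (Or.inr (by norm_num))).tendsto.const_mul _).mono_left
      nhdsWithin_le_nhds
  have harg := hnum.pos_mul_atTop (by positivity) hinv
  have harctan := (Real.tendsto_arctan_atTop.mono_right nhdsWithin_le_nhds).comp harg
  exact (hinv.const_mul_atTop (by positivity : 0 < 6 * Real.sqrt 2)).atTop_mul_pos
    Real.pi_div_two_pos harctan
end
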